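/- Let F be a γ-pliable set family on a finite set V, let I be an inclusion-minimal cover of F such that every edge of I covers some F-core, let U be the union of all F-cores, let L be a laminar witness family for I augmented with V, let (S₀, S₁, …, S_ℓ) be a hollow chain in L, and for each i let a_i b_i be the unique edge of I covering S_i with a_i ∈ S_i. If b₀ ∈ U, then ℓ ≤ 2; moreover, if ℓ = 2 then a₁ ∉ U and b₀, b₁, a₂ all belong to the same F-core. -/

import Mathlib

open scoped Classical

namespace SFEC

variable {V : Type*}

/-- An edge (an unordered pair of distinct elements) `e` covers a set `S`
if exactly one endpoint of `e` lies in `S`. -/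
def Covers (e : Sym2 V) (S : Set V) : Prop :=
  ∃ u v : V, e = s(u, v) ∧ u ∈ S ∧ v ∉ S

/-- `delta I S` is the set of edges of `I` with exactly one endpoint in `S`. -/
noncomputable def delta (I : Finset (Sym2 V)) (S : Set V) : Finset (Sym2 V) :=
  I.filter (fun e => Covers e S)

/-- `d I S = |delta I S|`. -/
noncomputable def d (I : Finset (Sym2 V)) (S : Set V) : ℕ := (delta I S).card

/-- A set family on `V`: a collection of subsets with `∅ ∉ F` and `V ∉ F`. -/
def IsSetFamily (F : Set (Set V)) : Prop := ∅ ∉ F ∧ Set.univ ∉ F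

/-- `I` covers the family `F` if it covers every member of `F`. -/
def CoversFam (I : Finset (Sym2 V)) (F : Set (Set V)) : Prop := ∀ S ∈ F, 1 ≤ d I S

/-- `I` is an inclusion-minimal cover of `F`. -/
def MinimalCover (I : Finset (Sym2 V)) (F : Set (Set V)) : Prop :=
  CoversFam I F ∧ ∀ J : Finset (Sym2 V), J ⊂ I → ¬ CoversFam J F

/-- At least two of the four statements hold. -/
def AtLeastTwo (p q r s : Prop) : Prop :=
  (p ∧ q) ∨ (p ∧ r) ∨ (p ∧ s) ∨ (q ∧ r) ∨ (q ∧ s) ∨ (r ∧ s)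

/-- A family is pliable if for all `A, B ∈ F` at least two of the four sets
`A ∩ B, A ∪ B, A \ B, B \ A` belong to `F`. -/
def Pliable (F : Set (Set V)) : Prop :=
  ∀ A ∈ F, ∀ B ∈ F, AtLeastTwo (A ∩ B ∈ F) (A ∪ B ∈ F) (A \ B ∈ F) (B \ A ∈ F)

/-- The residual family `F^I`: the members of `F` covered by no edge of `I`. -/
def Residual (F : Set (Set V)) (I : Finset (Sym2 V)) : Set (Set V) := {S ∈ F | d I S = 0}

/-- `A` and `B` cross if `A ∩ B`, `A \ B`, `B \ A` and `V \ (A ∪ B)` are all nonempty. -/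
def Crosses (A B : Set V) : Prop :=
  (A ∩ B).Nonempty ∧ (A \ B).Nonempty ∧ (B \ A).Nonempty ∧ ((A ∪ B)ᶜ : Set V).Nonempty

/-- An `F`-core: an inclusion-minimal member of `F`. -/
def Core (F : Set (Set V)) (C : Set V) : Prop := C ∈ F ∧ ∀ A ∈ F, A ⊆ C → A = C

/-- Property (γ). -/
def PropertyGamma (F : Set (Set V)) : Prop :=
  ∀ (J : Finset (Sym2 V)) (S₁ S₂ C : Set V),
    S₁ ∈ Residual F J → S₂ ∈ Residual F J → S₁ ⊂ S₂ →
    Core (Residual F J) C → Crosses C S₁ → Crosses C S₂ →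
    S₂ \ (S₁ ∪ C) = ∅ ∨ S₂ \ (S₁ ∪ C) ∈ Residual F J

/-- `F` is γ-pliable: pliable and satisfying Property (γ). -/
def GammaPliable (F : Set (Set V)) : Prop := Pliable F ∧ PropertyGamma F

/-- `S` is a witness set for the edge `e ∈ I` if `δ_I(S) = {e}`. -/
def WitnessSet (F : Set (Set V)) (I : Finset (Sym2 V)) (S : Set V) (e : Sym2 V) : Prop :=
  S ∈ F ∧ delta I S = {e}

/-- `L ⊆ F` is a witness family for `I`: `|L| = |I|` and each `e ∈ I` has a witness set in `L`. -/
def WitnessFamily (F : Set (Set V)) (I : Finset (Sym2 V)) (L : Finset (Set V)) : Prop :=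
  ↑L ⊆ F ∧ L.card = I.card ∧ ∀ e ∈ I, ∃ S ∈ L, WitnessSet F I S e

/-- A family is laminar if any two members are disjoint or one contains the other. -/
def Laminar (L : Finset (Set V)) : Prop :=
  ∀ A ∈ L, ∀ B ∈ L, A ⊆ B ∨ B ⊆ A ∨ Disjoint A B

/-- `S ∈ L` owns `C` if `S` is the inclusion-minimal member of `L` containing `C`. -/
def Owns (L : Finset (Set V)) (S C : Set V) : Prop :=
  S ∈ L ∧ C ⊆ S ∧ ∀ T ∈ L, C ⊆ T → S ⊆ T

/-- `S ∈ L` is hollow if it owns no `F`-core. -/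
def Hollow (F : Set (Set V)) (L : Finset (Set V)) (S : Set V) : Prop :=
  S ∈ L ∧ ∀ C : Set V, Core F C → ¬ Owns L S C

/-- `A` is the unique child of `S` in `L`: the unique maximal member of `L`
properly contained in `S`. -/
def UniqueChild (L : Finset (Set V)) (A S : Set V) : Prop :=
  A ∈ L ∧ A ⊂ S ∧ ∀ B ∈ L, B ⊂ S → B ⊆ A

/-- `(S 0, S 1, …, S ℓ)` is a hollow chain in `L`. -/
def HollowChain (F : Set (Set V)) (L : Finset (Set V)) (S : ℕ → Set V) (ℓ : ℕ) : Prop :=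
  (∀ i ≤ ℓ, S i ∈ L) ∧
  (∀ i, 1 ≤ i → i ≤ ℓ → Hollow F L (S i)) ∧
  S ℓ ≠ Set.univ ∧
  (∀ i, 1 ≤ i → i ≤ ℓ → UniqueChild L (S (i - 1)) (S i))

/-- `U`: the union of all `F`-cores. -/
def coreUnion (F : Set (Set V)) : Set V := ⋃₀ {C | Core F C}

/-- `F` is uncrossable. -/
def Uncrossable (F : Set (Set V)) : Prop :=
  ∀ A ∈ F, ∀ B ∈ F, (A ∩ B ∈ F ∧ A ∪ B ∈ F) ∨ (A \ B ∈ F ∧ B \ A ∈ F)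

/-- `F` is semi-uncrossable. -/
def SemiUncrossable (F : Set (Set V)) : Prop :=
  ∀ A ∈ F, ∀ B ∈ F,
    (A ∩ B ∈ F ∧ (A ∪ B ∈ F ∨ A \ B ∈ F ∨ B \ A ∈ F)) ∨ (A \ B ∈ F ∧ B \ A ∈ F)

end SFEC

open SFEC

namespace SFEC

section

variable {V : Type*} {F : Set (Set V)} {C D A B : Set V}

theorem Core.nonempty (hF : IsSetFamily F) (hC : Core F C) : C.Nonempty := by
  rw [Set.nonempty_iff_ne_empty]
  rintro rfl
  exact hF.1 hC.1

/-- In a pliable family, a core meeting a member of the family and not contained in it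
crosses it. -/
theorem Core.crosses (hF : IsSetFamily F) (hp : Pliable F) (hC : Core F C) (hA : A ∈ F)
    (hCA : (C ∩ A).Nonempty) (hnot : ¬ C ⊆ A) : Crosses C A := by
  have hinter : C ∩ A ∉ F := fun h =>
    hnot (Set.inter_eq_left.1 (hC.2 _ h Set.inter_subset_left))
  have hdiff : C \ A ∉ F := fun h => by
    obtain ⟨x, hxC, hxA⟩ := hCA
    have hx : x ∈ C \ A := by rwa [hC.2 _ h Set.sdiff_subset]
    exact hx.2 hxA
  have hrest : C ∪ A ∈ F ∧ A \ C ∈ F := by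
    have := hp C hC.1 A hA
    unfold AtLeastTwo at this
    tauto
  refine ⟨hCA, Set.sdiff_nonempty.2 hnot, ?_, ?_⟩
  · rw [Set.nonempty_iff_ne_empty]
    intro h
    exact hF.1 (h ▸ hrest.2)
  · rw [Set.nonempty_compl]
    intro h
    exact hF.2 (h ▸ hrest.1)

/-- Two cores of a pliable family that share an element are equal. -/
theorem Core.eq_of_mem (hp : Pliable F) (hC : Core F C) (hD : Core F D)
    {x : V} (hxC : x ∈ C) (hxD : x ∈ D) : C = D := by
  by_contra hne
  have hCD : ¬ C ⊆ D := fun h => hne (hD.2 C hC.1 h)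
  have hinter : C ∩ D ∉ F := fun h =>
    hCD (Set.inter_eq_left.1 (hC.2 _ h Set.inter_subset_left))
  have hdiff : C \ D ∉ F := fun h => by
    have hx : x ∈ C \ D := by rwa [hC.2 _ h Set.sdiff_subset]
    exact hx.2 hxD
  have hdiff' : D \ C ∉ F := fun h => by
    have hx : x ∈ D \ C := by rwa [hD.2 _ h Set.sdiff_subset]
    exact hx.2 hxC
  have := hp C hC.1 D hD.1
  unfold AtLeastTwo at this
  tauto

theorem exists_core_subset [Finite V] (hA : A ∈ F) : ∃ C, Core F C ∧ C ⊆ A := by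
  obtain ⟨C, hCA, hC⟩ := (Set.toFinite F).exists_le_minimal hA
  exact ⟨C, ⟨hC.prop, fun B hB hBC => hBC.antisymm (hC.le_of_le hB hBC)⟩, hCA⟩

/-- An edge with both ends in a single core of a pliable family covers no core. -/
theorem Core.not_covers (hp : Pliable F) (hC : Core F C) {u v : V}
    (hu : u ∈ C) (hv : v ∈ C) (hD : Core F D) : ¬ Covers s(u, v) D := by
  rintro ⟨x, y, hxy, hx, hy⟩
  have hmem : x ∈ C ∧ y ∈ C := by
    rcases Sym2.eq_iff.1 hxy with ⟨rfl, rfl⟩ | ⟨rfl, rfl⟩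
    · exact ⟨hu, hv⟩
    · exact ⟨hv, hu⟩
  obtain rfl := hC.eq_of_mem hp hD hmem.1 hx
  exact hy hmem.2

theorem residual_empty : Residual F ∅ = F := by
  simp [Residual, d, delta]

/-- If every core inside `B` lies inside `A`, then a core that meets `A` without being contained
in `B` contains `B \ A`. -/
theorem Core.diff_subset [Finite V] (hF : IsSetFamily F) (hgp : GammaPliable F) (hC : Core F C)
    (hA : A ∈ F) (hB : B ∈ F) (hAB : A ⊂ B) (hcores : ∀ D, Core F D → D ⊆ B → D ⊆ A)
    (hCA : (C ∩ A).Nonempty) (hnot : ¬ C ⊆ B) : B \ A ⊆ C := by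
  have hCB : (C ∩ B).Nonempty := hCA.mono (Set.inter_subset_inter_right _ hAB.1)
  have hγ := hgp.2 ∅ A B C
  rw [residual_empty] at hγ
  rcases hγ hA hB hAB hC (hC.crosses hF hgp.1 hA hCA fun h => hnot (h.trans hAB.1))
    (hC.crosses hF hgp.1 hB hCB hnot) with h | h
  · rwa [← Set.sdiff_sdiff, Set.sdiff_eq_empty] at h
  · obtain ⟨D, hD, hDs⟩ := exists_core_subset h
    obtain ⟨x, hx⟩ := hD.nonempty hF
    exact absurd (Or.inl (hcores D hD (hDs.trans Set.sdiff_subset) hx)) (hDs hx).2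

theorem Covers.of_mem {u v : V} (hu : u ∈ A) (hv : v ∉ A) : Covers s(u, v) A :=
  ⟨u, v, rfl, hu, hv⟩

variable {I : Finset (Sym2 V)} {L : Finset (Set V)}

/-- Distinct members of a witness family are covered by distinct edges. -/
theorem WitnessFamily.injOn_delta (hWF : WitnessFamily F I L) :
    Set.InjOn (delta I) (L : Set (Set V)) := by
  rw [← Finset.card_image_iff]
  refine le_antisymm Finset.card_image_le ?_
  have hsub : I.image (fun e => ({e} : Finset (Sym2 V))) ⊆ L.image (delta I) := by
    intro s hs
    obtain ⟨e, he, rfl⟩ := Finset.mem_image.1 hs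
    obtain ⟨T, hT, hTe⟩ := hWF.2.2 e he
    exact Finset.mem_image.2 ⟨T, hT, hTe.2⟩
  have hcard := Finset.card_le_card hsub
  rwa [Finset.card_image_of_injective _ Finset.singleton_injective, ← hWF.2.1] at hcard

/-- The edge of `I` covering a member of a witness family covers no other member. -/
theorem WitnessFamily.not_covers (hWF : WitnessFamily F I L) (hA : A ∈ L) (hB : B ∈ L)
    (hne : A ≠ B) {e f : Sym2 V} (he : delta I A = {e}) (hf : delta I B = {f}) :
    ¬ Covers e B := by
  intro hcov
  have heI : e ∈ I := Finset.mem_of_mem_filter e (he ▸ Finset.mem_singleton_self e)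
  have hmem : e ∈ delta I B := Finset.mem_filter.2 ⟨heI, hcov⟩
  rw [hf, Finset.mem_singleton] at hmem
  exact hne (hWF.injOn_delta hA hB (by rw [he, hf, hmem]))

/-- A core contained in a hollow set with a unique child is contained in the child. -/
theorem Hollow.core_subset_child (hF : IsSetFamily F) (hlam : Laminar L) (hBL : B ∈ L)
    (hB : Hollow F (insert Set.univ L) B) (hAB : UniqueChild (insert Set.univ L) A B)
    (hC : Core F C) (hCB : C ⊆ B) : C ⊆ A := by
  have hown := hB.2 C hC
  simp only [Owns, hB.1, hCB, true_and, not_forall] at hown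
  obtain ⟨T, hT, hCT, hBT⟩ := hown
  have hTL : T ∈ L := by
    rcases Finset.mem_insert.1 hT with rfl | h
    · exact absurd (Set.subset_univ _) hBT
    · exact h
  rcases hlam B hBL T hTL with h | h | h
  · exact absurd h hBT
  · exact hCT.trans (hAB.2.2 T hT ⟨h, hBT⟩)
  · obtain ⟨x, hx⟩ := hC.nonempty hF
    exact absurd (hCT hx) (Set.disjoint_left.1 h (hCB hx))

end

end SFEC

theorem stmt_13
    {V : Type*} [Fintype V]
    (F : Set (Set V)) (hF : IsSetFamily F) (hgp : GammaPliable F)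
    (I : Finset (Sym2 V)) (hIe : ∀ e ∈ I, ¬ e.IsDiag)
    (hmin : MinimalCover I F)
    (hcov : ∀ e ∈ I, ∃ C : Set V, Core F C ∧ Covers e C)
    (L : Finset (Set V)) (hWF : WitnessFamily F I L) (hlam : Laminar L)
    (S : ℕ → Set V) (ℓ : ℕ)
    (hchain : HollowChain F (insert Set.univ L) S ℓ)
    (a b : ℕ → V)
    (hedge : ∀ i ≤ ℓ, s(a i, b i) ∈ I ∧ a i ∈ S i ∧ b i ∉ S i ∧
      delta I (S i) = {s(a i, b i)})
    (hbU : b 0 ∈ coreUnion F) :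
    ℓ ≤ 2 ∧ (ℓ = 2 → a 1 ∉ coreUnion F ∧
      ∃ C : Set V, Core F C ∧ b 0 ∈ C ∧ b 1 ∈ C ∧ a 2 ∈ C) := by
  obtain ⟨hSL, hhol, -, hchild⟩ := hchain
  have hp := hgp.1
  have hmem : ∀ i ≤ ℓ, S i ∈ L := fun i hi => by
    refine (Finset.mem_insert.1 (hSL i hi)).resolve_left fun h => ?_
    exact (hedge i hi).2.2.1 (h ▸ Set.mem_univ _)
  have hSF : ∀ i ≤ ℓ, S i ∈ F := fun i hi => hWF.1 (hmem i hi)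
  have hss : ∀ i, i + 1 ≤ ℓ → S i ⊂ S (i + 1) := fun i hi =>
    (hchild (i + 1) (Nat.le_add_left 1 i) hi).2.1
  have hcore : ∀ i, i + 1 ≤ ℓ → ∀ C, Core F C → C ⊆ S (i + 1) → C ⊆ S i := fun i hi C hC h =>
    (hhol (i + 1) (Nat.le_add_left 1 i) hi).core_subset_child hF hlam (hmem _ hi)
      (hchild (i + 1) (Nat.le_add_left 1 i) hi) hC h
  have hb : ∀ i, i + 1 ≤ ℓ → b i ∈ S (i + 1) \ S i := fun i hi => by
    have hi' : i ≤ ℓ := Nat.le_of_succ_le hi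
    refine ⟨?_, (hedge i hi').2.2.1⟩
    by_contra hnot
    exact hWF.not_covers (hmem i hi') (hmem _ hi) (hss i hi).ne (hedge i hi').2.2.2
      (hedge _ hi).2.2.2 (Covers.of_mem ((hss i hi).1 (hedge i hi').2.1) hnot)
  have ha : ∀ i, i + 1 ≤ ℓ → a (i + 1) ∈ S (i + 1) \ S i := fun i hi => by
    have hi' : i ≤ ℓ := Nat.le_of_succ_le hi
    refine ⟨(hedge _ hi).2.1, fun hin => ?_⟩
    exact hWF.not_covers (hmem _ hi) (hmem i hi') (hss i hi).ne' (hedge _ hi).2.2.2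
      (hedge i hi').2.2.2
      (Covers.of_mem hin fun h => (hedge _ hi).2.2.1 ((hss i hi).1 h))
  -- a core meeting `S 1 \ S 0` lies inside no `S (i + 1)`, hence contains every later difference
  have hnot : ∀ C, Core F C → (C ∩ (S 1 \ S 0)).Nonempty → ∀ i ≤ ℓ, ¬ C ⊆ S i := by
    rintro C hC ⟨x, hxC, -, hx0⟩ i
    induction i with
    | zero => exact fun _ h => hx0 (h hxC)
    | succ i ih => exact fun hi h => ih (Nat.le_of_succ_le hi) (hcore i hi C hC h)
  have hmeet : ∀ C, (C ∩ (S 1 \ S 0)).Nonempty → ∀ i, i + 1 ≤ ℓ → (C ∩ S (i + 1)).Nonempty := by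
    rintro C ⟨x, hxC, hx1, -⟩ i
    induction i with
    | zero => exact fun _ => ⟨x, hxC, hx1⟩
    | succ i ih =>
      exact fun hi => (ih (Nat.le_of_succ_le hi)).mono
        (Set.inter_subset_inter_right _ (hss _ hi).1)
  have hdiff : ∀ C, Core F C → (C ∩ (S 1 \ S 0)).Nonempty → ∀ i, i + 2 ≤ ℓ →
      S (i + 2) \ S (i + 1) ⊆ C := fun C hC hx i hi =>
    have hi' : i + 1 ≤ ℓ := Nat.le_of_succ_le hi
    hC.diff_subset hF hgp (hSF _ hi') (hSF _ hi) (hss _ hi) (hcore _ hi) (hmeet C hx i hi')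
      (hnot C hC hx _ hi)
  obtain ⟨C, hC : Core F C, hbC⟩ := hbU
  constructor
  · by_contra! h3
    have hx : (C ∩ (S 1 \ S 0)).Nonempty := ⟨b 0, hbC, hb 0 (by lia)⟩
    obtain ⟨D, hD, hcovD⟩ := hcov _ (hedge 2 (by lia)).1
    exact hC.not_covers hp (hdiff C hC hx 0 (by lia) (ha 1 (by lia)))
      (hdiff C hC hx 1 (by lia) (hb 2 (by lia))) hD hcovD
  · rintro rfl
    have hx : (C ∩ (S 1 \ S 0)).Nonempty := ⟨b 0, hbC, hb 0 (by lia)⟩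
    have hb1 : b 1 ∈ C := hdiff C hC hx 0 le_rfl (hb 1 le_rfl)
    refine ⟨?_, C, hC, hbC, hb1, hdiff C hC hx 0 le_rfl (ha 1 le_rfl)⟩
    rintro ⟨D, hD : Core F D, haD⟩
    have hb1D : b 1 ∈ D := hdiff D hD ⟨a 1, haD, ha 0 (by lia)⟩ 0 le_rfl (hb 1 le_rfl)
    obtain ⟨E, hE, hcovE⟩ := hcov _ (hedge 1 (by lia)).1
    exact hD.not_covers hp haD hb1D hE hcovE
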